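/- Let N ≥ 1, and let k : {1,…,N}×{1,…,N} → ℝ be symmetric (k_{ij} = k_{ji}) with zero row sums (∑_{j=1}^N k_{ij} = 0 for every i) and nonnegative off-diagonal entries (k_{ij} ≥ 0 for i ≠ j). Let d ≥ 1, let n_1,…,n_N be unit vectors in ℝ^d, let s_1,…,s_N ∈ ℝ, set s̃_i := |s_i| and ũ_i := |s_i|·n_i, and let κ > 0. Then (κ/2) ∑_{i,j} k_{ij} (s_i − s_j)² + (1/2) ∑_{i,j} k_{ij} ((s_i² + s_j²)/2) ‖n_i − n_j‖² ≥ (κ − 1)·(1/2) ∑_{i,j} k_{ij} (s̃_i − s̃_j)² + (1/2) ∑_{i,j} k_{ij} ‖ũ_i − ũ_j‖². -/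

import Mathlib

theorem norm_smul_sub_smul_sq_of_norm_eq_one {E : Type*} [NormedAddCommGroup E]
    [InnerProductSpace ℝ E] {x y : E} (hx : ‖x‖ = 1) (hy : ‖y‖ = 1) (a b : ℝ) :
    ‖a • x - b • y‖ ^ 2 = (a - b) ^ 2 + a * b * ‖x - y‖ ^ 2 := by
  rw [norm_sub_sq_real, norm_sub_sq_real, real_inner_smul_left, real_inner_smul_right,
    norm_smul, norm_smul, hx, hy, mul_one, mul_one, Real.norm_eq_abs, Real.norm_eq_abs,
    sq_abs, sq_abs]
  ring


/-- Inequality (2.16) of Lemma 2.2 (energy inequality):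
`E₁ʰ[sₕ,nₕ] ≥ Ẽ₁ʰ[s̃ₕ,ũₕ]` with `s̃ᵢ = |sᵢ|`, `ũᵢ = |sᵢ|•nᵢ`,
on a weakly acute mesh. -/
theorem discrete_energy_inequality_abs
    (N : ℕ) (hN : 1 ≤ N) (k : Fin N → Fin N → ℝ)
    (hsym : ∀ i j, k i j = k j i)
    (hrow : ∀ i, ∑ j, k i j = 0)
    (hpos : ∀ i j, i ≠ j → 0 ≤ k i j)
    (d : ℕ) (hd : 1 ≤ d)
    (n : Fin N → EuclideanSpace ℝ (Fin d)) (hn : ∀ i, ‖n i‖ = 1)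
    (s : Fin N → ℝ)
    (stilde : Fin N → ℝ) (hst : ∀ i, stilde i = |s i|)
    (utilde : Fin N → EuclideanSpace ℝ (Fin d)) (hut : ∀ i, utilde i = |s i| • n i)
    (κ : ℝ) (hκ : 0 < κ) :
    (κ / 2) * ∑ i, ∑ j, k i j * (s i - s j) ^ 2
      + (1 / 2) * ∑ i, ∑ j, k i j * ((s i ^ 2 + s j ^ 2) / 2) * ‖n i - n j‖ ^ 2
    ≥ (κ - 1) * ((1 / 2) * ∑ i, ∑ j, k i j * (stilde i - stilde j) ^ 2)
      + (1 / 2) * ∑ i, ∑ j, k i j * ‖utilde i - utilde j‖ ^ 2 := by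
  simp only [ge_iff_le, hst, hut, Finset.mul_sum, ← Finset.sum_add_distrib]
  refine Finset.sum_le_sum fun i _ => Finset.sum_le_sum fun j _ => ?_
  rcases eq_or_ne i j with rfl | hij
  · simp
  rw [norm_smul_sub_smul_sq_of_norm_eq_one (hn i) (hn j)]
  have hs : (|s i| - |s j|) ^ 2 ≤ (s i - s j) ^ 2 :=
    sq_le_sq.mpr (abs_abs_sub_abs_le_abs_sub (s i) (s j))
  have hab : |s i| * |s j| ≤ (s i ^ 2 + s j ^ 2) / 2 := by
    rw [← sq_abs (s i), ← sq_abs (s j)]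
    linarith [two_mul_le_add_sq |s i| |s j|]
  have hκs := mul_le_mul_of_nonneg_left hs hκ.le
  have habn := mul_le_mul_of_nonneg_right hab (sq_nonneg ‖n i - n j‖)
  linarith [mul_le_mul_of_nonneg_left (add_le_add hκs habn) (hpos i j hij)]
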